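/- For every ordinal Ω: (a) H₀(Ω) is closed under the boolean operations, i.e., if A, B ∈ H₀(Ω) then A ∪ B, A ∩ B, and Ω ∖ A belong to H₀(Ω); and (b) every interval contained in Ω, i.e., every set of the form {x : γ ≤ x < δ} with δ ≤ Ω, belongs to H₀(Ω). -/

import Mathlib

open Ordinal Set Filter

/-- `X` is ultimately periodic in `Ω` with offset length `δ`, period length `π`
and exponent `lam`. -/
def UPWith (X : Set Ordinal) (Ω δ π lam : Ordinal) : Prop :=
  δ < Ω ∧ 0 < π ∧ Order.IsSuccLimit lam ∧ Ω = δ + π * lam ∧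
    ∀ γ < lam, ∀ ξ < π, (δ + π * γ + ξ ∈ X ↔ δ + ξ ∈ X)

/-- `X` is ultimately periodic in `Ω` with offset length `δ` and period length `π`. -/
def UPIn (X : Set Ordinal) (Ω δ π : Ordinal) : Prop := ∃ lam, UPWith X Ω δ π lam

/-- `X` is ultimately periodic in `Ω`. -/
def UP (X : Set Ordinal) (Ω : Ordinal) : Prop := ∃ δ π, UPIn X Ω δ π

/-- `X` is periodic in `Ω` with period length `π`. -/
def PeriodicIn (X : Set Ordinal) (Ω π : Ordinal) : Prop := UPIn X Ω 0 π

/-- `H₀(Ω)`: the family of subsets of `Ω` that are hereditarily periodic in `Ω`. -/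
def H0 (Ω : Ordinal) : Set (Set Ordinal) :=
  {X | X ⊆ Set.Iio Ω ∧ ∀ β ≤ Ω, Order.IsSuccLimit β → UP (X ∩ Set.Iio β) β}

/-- `ℓ(α)`: the last (smallest) exponent in the Cantor normal form of `α`, with `ℓ(0) = 0`. -/
noncomputable def ell (α : Ordinal) : Ordinal :=
  (((Ordinal.CNF Ordinal.omega0 α).getLast?).map Prod.fst).getD 0

/-- The derived-set operator of a topology `t`. -/
def dSet {X : Type*} (t : TopologicalSpace X) (S : Set X) : Set X :=
  {x | @AccPt X t x (Filter.principal S)}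

/-- `d₀`: the derived-set operator of the order (interval) topology on the ordinals. -/
noncomputable def d0 : Set Ordinal → Set Ordinal := dSet inferInstance

/-- Icard's topology `ϑ_n` on the ordinals. -/
noncomputable def icard (n : ℕ) : TopologicalSpace Ordinal :=
  TopologicalSpace.generateFrom
    ({U | IsOpen U} ∪
      {U | ∃ m : ℕ, 1 ≤ m ∧ m ≤ n ∧ ∃ β : Ordinal, U = {α | β < ell^[m] α}})

/-- `d_n`: the derived-set operator of Icard's topology `ϑ_n`. -/
noncomputable def dIcard (n : ℕ) : Set Ordinal → Set Ordinal := dSet (icard n)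

/-- The base family `V_n(Ω)` of `n`-periodic subsets of `Ω`. -/
def Vn : ℕ → Ordinal → Set (Set Ordinal)
  | 0, Ω => H0 Ω
  | (n+1), Ω => {S | ∃ B ∈ H0 Ω, ∃ A ∈ Vn n Ω, S = B ∩ {α | α < Ω ∧ ell α ∈ A}}

/-- `H_n(Ω)`: finite unions of members of `V_n(Ω)`, the `n`-periodic subsets of `Ω`. -/
def Hn (n : ℕ) (Ω : Ordinal) : Set (Set Ordinal) :=
  {S | ∃ F : Finset (Set Ordinal), ↑F ⊆ Vn n Ω ∧ S = ⋃₀ ↑F}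

theorem upw_shift {X : Set Ordinal} {β δ π a l : Ordinal} (h : UPWith X β δ π (a + l))
    (hl : Order.IsSuccLimit l) : UPWith X β (δ + π * a) π l := by
  obtain ⟨h1, h2, h3, h4, h5⟩ := h
  have l0 : 0 < l := by
    have := one_lt_of_isSuccLimit hl
    exact lt_trans zero_lt_one this
  have e : β = δ + π * a + π * l := by rw [h4, mul_add, add_assoc]
  refine ⟨?_, h2, hl, e, ?_⟩
  · rw [e]
    exact lt_add_of_pos_right _ (mul_pos h2 l0)
  · intro γ hγ ξ hξ
    rw [h5 a (lt_add_of_pos_right _ l0) ξ hξ, add_assoc δ, ← mul_add]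
    exact h5 _ (add_lt_add_right hγ a) ξ hξ

theorem upw_coarsen {X : Set Ordinal} {β δ π a l : Ordinal} (h : UPWith X β δ π (a * l))
    (ha : 0 < a) (hl : Order.IsSuccLimit l) : UPWith X β δ (π * a) l := by
  obtain ⟨h1, h2, h3, h4, h5⟩ := h
  refine ⟨h1, mul_pos h2 ha, hl, by rw [h4, mul_assoc], ?_⟩
  intro γ hγ ξ hξ
  obtain ⟨q, hq, r, hr, rfl⟩ := lt_mul_iff.1 hξ
  have hlt : a * γ + q < a * l := lt_mul_iff.2 ⟨γ, hγ, q, hq, rfl⟩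
  have hq' : q < a * l := by
    refine lt_of_le_of_lt ?_ hlt
    exact le_add_self
  rw [← add_assoc, ← add_assoc, h5 q hq' r hr, ← h5 _ hlt r hr, mul_add, mul_assoc]
  simp only [add_assoc]

theorem exists_tail (l : Ordinal) (hl : Order.IsSuccLimit l) :
    ∃ a s : Ordinal, s ≠ 0 ∧ l = a + ω ^ s := by
  have hl0 : l ≠ 0 := (isSuccLimit_iff.1 hl).1
  have hne : {k : Ordinal | k ≠ 0 ∧ ∃ a, l = a + k}.Nonempty := ⟨l, hl0, 0, by simp⟩
  obtain ⟨k, ⟨hk0, a, hka⟩, hmin⟩ :=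
    WellFounded.has_min (wellFounded_lt (α := Ordinal)) _ hne
  have hp : IsPrincipal (· + ·) k := by
    rw [isPrincipal_add_iff_add_left_eq_self]
    intro b hb
    have e := Ordinal.add_sub_cancel_of_le hb.le
    have h0 : k - b ≠ 0 := by
      intro h
      rw [h, add_zero] at e
      exact hb.ne e
    have : ¬ k - b < k := hmin (k - b) ⟨h0, a + b, by rw [hka, add_assoc, e]⟩
    have h2 : k - b = k := le_antisymm (sub_le_self k b) (not_lt.1 this)
    rwa [h2] at e
  rcases isPrincipal_add_iff_zero_or_omega0_opow.1 hp with h | ⟨s, rfl⟩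
  · exact absurd h hk0
  · refine ⟨a, s, ?_, hka⟩
    rintro rfl
    simp only [opow_zero] at hka
    rw [hka, ← Order.succ_eq_add_one] at hl
    exact Order.not_isSuccLimit_succ _ hl

theorem limit_omega_opow {s : Ordinal} (hs : s ≠ 0) : Order.IsSuccLimit (ω ^ s) :=
  isSuccLimit_opow_left isSuccLimit_omega0 hs

/-- Normal form when the tail of `β` has successor exponent. -/
def NFS (X : Set Ordinal) (β δ τ : Ordinal) (n : ℕ) : Prop :=
  0 < n ∧ β = δ + ω ^ Order.succ τ ∧
    ∀ y, ω ^ τ ≤ y → y < ω ^ Order.succ τ → (δ + (ω ^ τ * n + y) ∈ X ↔ δ + y ∈ X)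

theorem mul_nat_lt (τ : Ordinal) (n : ℕ) : ω ^ τ * n < ω ^ Order.succ τ := by
  rw [opow_succ]
  exact mul_lt_mul_of_pos_left (natCast_lt_omega0 n) (opow_pos _ omega0_pos)

theorem NFS.mul {X : Set Ordinal} {β δ τ : Ordinal} {n : ℕ} (h : NFS X β δ τ n) (k : ℕ)
    (hk : 0 < k) : NFS X β δ τ (n * k) := by
  obtain ⟨h1, h2, h3⟩ := h
  refine ⟨Nat.mul_pos h1 hk, h2, ?_⟩
  clear hk
  induction k with
  | zero => intro y _ _; simp
  | succ k ih =>
    intro y hy hy'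
    have e : ω ^ τ * ((n * (k + 1) : ℕ) : Ordinal) + y
        = ω ^ τ * ((n * k : ℕ) : Ordinal) + (ω ^ τ * n + y) := by
      rw [Nat.mul_succ, Nat.cast_add, mul_add, add_assoc]
    rw [e, ih _ (hy.trans le_add_self)
      (isPrincipal_add_omega0_opow _ (mul_nat_lt τ n) hy'), h3 y hy hy']

theorem NFS.shift {X : Set Ordinal} {β δ τ : Ordinal} {n : ℕ} (h : NFS X β δ τ n) (ε : Ordinal)
    (hε : ε < ω ^ Order.succ τ) : NFS X β (δ + ε) τ n := by
  obtain ⟨h1, h2, h3⟩ := h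
  refine ⟨h1, by rw [h2, add_assoc, add_omega0_opow hε], ?_⟩
  intro y hy hy'
  have hε' := hε
  rw [opow_succ] at hε'
  obtain ⟨q, hq, t, ht, rfl⟩ := lt_mul_iff.1 hε'
  obtain ⟨k, rfl⟩ := lt_omega0.1 hq
  have e1 : t + y = y := add_of_omega0_opow_le ht hy
  have e2 : t + (ω ^ τ * n + y) = ω ^ τ * n + y :=
    add_of_omega0_opow_le ht (hy.trans le_add_self)
  have e : ω ^ τ * (k : Ordinal) + t + (ω ^ τ * n + y)
      = ω ^ τ * n + (ω ^ τ * (k : Ordinal) + t + y) := by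
    rw [add_assoc, add_assoc, e1, e2, ← add_assoc, ← add_assoc, ← mul_add, ← mul_add,
      ← Nat.cast_add, ← Nat.cast_add, Nat.add_comm]
  rw [add_assoc δ, add_assoc δ, e]
  exact h3 _ (hy.trans le_add_self) (isPrincipal_add_omega0_opow _ hε hy')

theorem NFS.upw {X : Set Ordinal} {β δ τ : Ordinal} {n : ℕ} (h : NFS X β δ τ n) :
    UPWith X β (δ + ω ^ τ) (ω ^ τ * n) ω := by
  obtain ⟨h1, h2, h3⟩ := h
  have hlt : ω ^ τ < ω ^ Order.succ τ :=
    (opow_lt_opow_iff_right one_lt_omega0).2 (Order.lt_succ τ)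
  have hn : (0 : Ordinal) < n := by exact_mod_cast h1
  refine ⟨?_, mul_pos (opow_pos _ omega0_pos) hn, isSuccLimit_omega0, ?_, ?_⟩
  · rw [h2]
    exact add_lt_add_right hlt δ
  · rw [mul_assoc, natCast_mul_omega0 h1, ← opow_succ, add_assoc, add_omega0_opow hlt, h2]
  · intro γ hγ ξ hξ
    obtain ⟨k, rfl⟩ := lt_omega0.1 hγ
    clear hγ
    induction k with
    | zero => simp
    | succ k ih =>
      rw [← ih]
      have e : ∀ j : ℕ, δ + ω ^ τ + ω ^ τ * n * (j : Ordinal) + ξ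
          = δ + (ω ^ τ * ((1 + n * j : ℕ) : Ordinal) + ξ) := by
        intro j
        rw [Nat.cast_add, mul_add, Nat.cast_one, mul_one, natCast_mul, mul_assoc]
        simp only [add_assoc]
      have e' : ω ^ τ * ((1 + n * (k + 1) : ℕ) : Ordinal) + ξ
          = ω ^ τ * n + (ω ^ τ * ((1 + n * k : ℕ) : Ordinal) + ξ) := by
        rw [← add_assoc, ← mul_add, ← Nat.cast_add]
        congr 3
        ring
      rw [e, e, e']
      refine h3 _ ?_ ?_
      · rw [Nat.cast_add, mul_add, Nat.cast_one, mul_one, add_assoc]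
        exact le_self_add
      · exact isPrincipal_add_omega0_opow _ (mul_nat_lt τ _) (hξ.trans (mul_nat_lt τ n))

theorem up_nf {X : Set Ordinal} {β : Ordinal} (h : UP X β) :
    (∃ δ τ n, NFS X β δ τ n) ∨
      ∃ δ τ σ : Ordinal, Order.IsSuccLimit σ ∧ UPWith X β δ (ω ^ τ) (ω ^ σ) := by
  obtain ⟨δ, π, l, h⟩ := h
  obtain ⟨a, s, hs, rfl⟩ := exists_tail l h.2.2.1
  replace h := upw_shift h (limit_omega_opow hs)
  generalize δ + π * a = δ' at h
  rcases zero_or_succ_or_isSuccLimit s with rfl | ⟨s, rfl⟩ | hlim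
  · exact absurd rfl hs
  · left
    rw [opow_succ] at h
    replace h := upw_coarsen h (opow_pos _ omega0_pos) isSuccLimit_omega0
    generalize π * ω ^ s = p at h
    obtain ⟨h1, h2, h3, h4, h5⟩ := h
    have hpω : p * ω = ω ^ Order.succ (log ω p) :=
      mul_eq_opow_log_succ h2.ne' isPrincipal_mul_omega0
        (by exact_mod_cast natCast_lt_omega0 2)
    obtain ⟨n, hn⟩ := lt_omega0.1 (div_opow_log_lt p one_lt_omega0)
    have hn0 := div_opow_log_pos ω h2.ne'
    have hdm := div_add_mod p (ω ^ log ω p)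
    rw [hn] at hn0 hdm
    have hr : p % ω ^ log ω p < ω ^ log ω p := mod_lt _ (opow_pos _ omega0_pos).ne'
    refine ⟨δ', log ω p, n, by exact_mod_cast hn0, by rw [h4, hpω], ?_⟩
    intro y hy hy'
    have e : ω ^ log ω p * n + y = p + y := by
      conv_rhs => rw [← hdm]
      rw [add_assoc, add_of_omega0_opow_le hr hy]
    rw [e]
    rw [← hpω] at hy'
    obtain ⟨q, hq, t, ht, rfl⟩ := lt_mul_iff.1 hy'
    have hq' : 1 + q < ω := isPrincipal_add_omega0 one_lt_omega0 hq
    have e' : δ' + (p + (p * q + t)) = δ' + p * (1 + q) + t := by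
      rw [mul_add, mul_one]
      simp only [add_assoc]
    rw [e', h5 _ hq' t ht, ← add_assoc, h5 _ hq t ht]
  · right
    have e : ω ^ s = ω * ω ^ s := by
      conv_rhs => rw [← opow_one_add]
      rw [one_add_of_omega0_le (omega0_le_of_isSuccLimit hlim)]
    rw [e] at h
    replace h := upw_coarsen h omega0_pos (limit_omega_opow hs)
    refine ⟨δ', Order.succ (log ω π), s, hlim, ?_⟩
    rwa [mul_eq_opow_log_succ] at h
    · rintro rfl
      have := h.2.1
      simp at this
    · exact isPrincipal_mul_omega0
    · exact_mod_cast natCast_lt_omega0 2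

theorem tail_unique {δ ε ρ ρ' : Ordinal} (h : δ + ω ^ ρ = δ + ε + ω ^ ρ') :
    ρ = ρ' ∧ ε < ω ^ ρ := by
  rw [add_assoc] at h
  have h := add_left_cancel h
  have hε : ε < ω ^ ρ := by
    rw [h]
    exact lt_add_of_pos_right _ (opow_pos _ omega0_pos)
  refine ⟨?_, hε⟩
  have hle : ω ^ ρ' ≤ ω ^ ρ := by
    rw [h]
    exact le_add_self
  rcases hle.lt_or_eq with hlt | he
  · exact absurd h (isPrincipal_add_omega0_opow ρ hε hlt).ne'
  · exact ((opow_right_inj one_lt_omega0).1 he).symm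

/-- Common periods. -/
def Common (A B : Set Ordinal) (β : Ordinal) : Prop :=
  ∃ δ π l, UPWith A β δ π l ∧ UPWith B β δ π l

theorem Common.symm {A B : Set Ordinal} {β : Ordinal} (h : Common A B β) : Common B A β := by
  obtain ⟨δ, π, l, h1, h2⟩ := h
  exact ⟨δ, π, l, h2, h1⟩

theorem common_succ {A B : Set Ordinal} {β δ ε τ τ' : Ordinal} {n m : ℕ}
    (hA : NFS A β δ τ n) (hB : NFS B β (δ + ε) τ' m) : Common A B β := by
  obtain ⟨e, hε⟩ := tail_unique (hA.2.1.symm.trans hB.2.1)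
  obtain rfl := Order.succ_injective e
  have hA' := ((hA.shift ε hε).mul m hB.1).upw
  have hB' := (hB.mul n hA.1).upw
  rw [Nat.mul_comm] at hB'
  exact ⟨_, _, _, hA', hB'⟩

theorem refine_lim {X : Set Ordinal} {β δ τ σ τ' ρ : Ordinal}
    (h : UPWith X β δ (ω ^ τ) (ω ^ σ)) (hρ : τ + σ = ρ) (h1 : τ ≤ τ') (h2 : τ' < ρ) :
    UPWith X β (δ + ω ^ τ') (ω ^ τ') (ω ^ (ρ - τ')) := by
  have e1 := Ordinal.add_sub_cancel_of_le h1
  have e2 := Ordinal.add_sub_cancel_of_le h2.le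
  have e3 : (τ' - τ) + (ρ - τ') = σ := by
    apply add_left_cancel (a := τ)
    rw [← add_assoc, e1, e2, hρ]
  have h0 : ρ - τ' ≠ 0 := by
    intro h
    rw [h, add_zero] at e2
    exact h2.ne e2
  rw [← e3, opow_add] at h
  have h := upw_coarsen h (opow_pos _ omega0_pos) (limit_omega_opow h0)
  rw [← opow_add, e1] at h
  have e4 : 1 + ω ^ (ρ - τ') = ω ^ (ρ - τ') :=
    add_omega0_opow (one_lt_of_isSuccLimit (limit_omega_opow h0))
  rw [← e4] at h
  have h := upw_shift h (limit_omega_opow h0)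
  rwa [mul_one] at h

theorem common_lim {A B : Set Ordinal} {β δ ε τ τ' σ σ' : Ordinal}
    (hσ : Order.IsSuccLimit σ) (hσ' : Order.IsSuccLimit σ')
    (hA : UPWith A β δ (ω ^ τ) (ω ^ σ)) (hB : UPWith B β (δ + ε) (ω ^ τ') (ω ^ σ')) :
    Common A B β := by
  have eA := hA.2.2.2.1
  have eB := hB.2.2.2.1
  rw [← opow_add] at eA eB
  obtain ⟨e, hε⟩ := tail_unique (eA.symm.trans eB)
  have hlim : Order.IsSuccLimit (τ + σ) := isSuccLimit_add τ hσ
  obtain ⟨η, hη, hη'⟩ := (lt_opow_of_isSuccLimit omega0_pos.ne' hlim).1 hε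
  have hτ : τ < τ + σ := lt_add_of_pos_right _ (lt_trans zero_lt_one (one_lt_of_isSuccLimit hσ))
  have hτ' : τ' < τ + σ := by
    rw [e]
    exact lt_add_of_pos_right _ (lt_trans zero_lt_one (one_lt_of_isSuccLimit hσ'))
  have hM : max η (max τ τ') < τ + σ := max_lt hη (max_lt hτ hτ')
  have hA' := refine_lim hA rfl ((le_max_left τ τ').trans (le_max_right η _)) hM
  have hB' := refine_lim hB e.symm ((le_max_right τ τ').trans (le_max_right η _)) hM
  have hεM : ε < ω ^ max η (max τ τ') :=
    hη'.trans_le (opow_le_opow_right omega0_pos (le_max_left _ _))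
  rw [add_assoc, add_omega0_opow hεM] at hB'
  exact ⟨_, _, _, hA', hB'⟩

theorem no_mixed {A B : Set Ordinal} {β δ τ δ' τ' σ : Ordinal} {n : ℕ}
    (hA : NFS A β δ τ n) (hσ : Order.IsSuccLimit σ)
    (hB : UPWith B β δ' (ω ^ τ') (ω ^ σ)) : False := by
  have eA := hA.2.1
  have eB := hB.2.2.2.1
  rw [← opow_add] at eB
  have hlim : Order.IsSuccLimit (τ' + σ) := isSuccLimit_add τ' hσ
  have e : Order.succ τ = τ' + σ := by
    rcases le_total δ δ' with h | h
    · obtain ⟨ε, rfl⟩ := exists_add_of_le h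
      exact (tail_unique (eA.symm.trans eB)).1
    · obtain ⟨ε, rfl⟩ := exists_add_of_le h
      exact (tail_unique (eB.symm.trans eA)).1.symm
  rw [← e] at hlim
  exact Order.not_isSuccLimit_succ _ hlim

theorem up_common {A B : Set Ordinal} {β : Ordinal} (hA : UP A β) (hB : UP B β) :
    Common A B β := by
  rcases up_nf hA with ⟨δ, τ, n, hA⟩ | ⟨δ, τ, σ, hσ, hA⟩ <;>
  rcases up_nf hB with ⟨δ', τ', n', hB⟩ | ⟨δ', τ', σ', hσ', hB⟩
  · rcases le_total δ δ' with h | h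
    · obtain ⟨ε, rfl⟩ := exists_add_of_le h
      exact common_succ hA hB
    · obtain ⟨ε, rfl⟩ := exists_add_of_le h
      exact (common_succ hB hA).symm
  · exact (no_mixed hA hσ' hB).elim
  · exact (no_mixed hB hσ hA).elim
  · rcases le_total δ δ' with h | h
    · obtain ⟨ε, rfl⟩ := exists_add_of_le h
      exact common_lim hσ hσ' hA hB
    · obtain ⟨ε, rfl⟩ := exists_add_of_le h
      exact (common_lim hσ' hσ hB hA).symm

theorem upw_lt {X : Set Ordinal} {β δ π l : Ordinal} (h : UPWith X β δ π l) {γ ξ : Ordinal}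
    (hγ : γ < l) (hξ : ξ < π) : δ + π * γ + ξ < β := by
  rw [h.2.2.2.1, add_assoc]
  exact add_lt_add_right (lt_mul_iff.2 ⟨γ, hγ, ξ, hξ, rfl⟩) δ

theorem up_const {X : Set Ordinal} {β d : Ordinal} (hβ : Order.IsSuccLimit β) (hd : d < β)
    (h : ∀ x, d ≤ x → x < β → (x ∈ X ↔ d ∈ X)) : UP X β := by
  have e := Ordinal.add_sub_cancel_of_le hd.le
  refine ⟨d, 1, β - d, hd, zero_lt_one, isSuccLimit_sub hβ.isSuccPrelimit hd, by simp [e], ?_⟩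
  intro γ hγ ξ hξ
  obtain rfl := Ordinal.lt_one_iff_zero.1 hξ
  rw [one_mul, add_zero, add_zero]
  refine h _ le_self_add ?_
  rw [← e]
  exact add_lt_add_right hγ d

/-- `H₀(Ω)` is closed under the boolean operations, and every interval contained
in `Ω` belongs to `H₀(Ω)`. -/
theorem H0_boolean_and_intervals (Ω : Ordinal) :
    (∀ A ∈ H0 Ω, ∀ B ∈ H0 Ω,
      A ∪ B ∈ H0 Ω ∧ A ∩ B ∈ H0 Ω ∧ Set.Iio Ω \ A ∈ H0 Ω) ∧
    (∀ γ δ : Ordinal, δ ≤ Ω → Set.Ico γ δ ∈ H0 Ω) := by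
  refine ⟨?_, ?_⟩
  · rintro A ⟨hA, hA'⟩ B ⟨hB, hB'⟩
    refine ⟨⟨union_subset hA hB, ?_⟩, ⟨inter_subset_left.trans hA, ?_⟩, ⟨diff_subset, ?_⟩⟩
    · intro β hβ hl
      obtain ⟨δ, π, l, h1, h2⟩ := up_common (hA' β hβ hl) (hB' β hβ hl)
      refine ⟨δ, π, l, h1.1, h1.2.1, h1.2.2.1, h1.2.2.2.1, ?_⟩
      intro γ hγ ξ hξ
      have a := h1.2.2.2.2 γ hγ ξ hξ
      have b := h2.2.2.2.2 γ hγ ξ hξ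
      rw [union_inter_distrib_right, mem_union, mem_union, a, b]
    · intro β hβ hl
      obtain ⟨δ, π, l, h1, h2⟩ := up_common (hA' β hβ hl) (hB' β hβ hl)
      refine ⟨δ, π, l, h1.1, h1.2.1, h1.2.2.1, h1.2.2.2.1, ?_⟩
      intro γ hγ ξ hξ
      have a := h1.2.2.2.2 γ hγ ξ hξ
      have b := h2.2.2.2.2 γ hγ ξ hξ
      rw [inter_inter_distrib_right]
      exact and_congr a b
    · intro β hβ hl
      obtain ⟨δ, π, l, h1⟩ := hA' β hβ hl
      refine ⟨δ, π, l, h1.1, h1.2.1, h1.2.2.1, h1.2.2.2.1, ?_⟩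
      intro γ hγ ξ hξ
      have a := h1.2.2.2.2 γ hγ ξ hξ
      have l1 := upw_lt h1 hγ hξ
      have l2 : δ + ξ < β := by
        simpa using upw_lt h1 (γ := 0) (lt_of_le_of_lt zero_le hγ) hξ
      have m1 := l1.trans_le hβ
      have m2 := l2.trans_le hβ
      simp only [mem_inter_iff, mem_Iio, l1, l2, and_true] at a
      simp only [mem_inter_iff, mem_diff, mem_Iio, l1, l2, m1, m2, and_true, true_and, a]
  · intro γ δ hδ
    refine ⟨fun x hx => hx.2.trans_le hδ, ?_⟩
    intro β hβ hl
    rcases lt_or_ge δ β with h | h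
    · refine up_const hl h fun x hx hx' => ?_
      simp [hx.not_gt]
    · rcases lt_or_ge γ β with h' | h'
      · refine up_const hl h' fun x hx hx' => ?_
        simp [hx, hx', h', hx'.trans_le h, h'.trans_le h]
      · have h0 : (0 : Ordinal) < β := lt_trans zero_lt_one (one_lt_of_isSuccLimit hl)
        refine up_const hl h0 fun x hx hx' => ?_
        simp [(hx'.trans_le h').not_ge, (h0.trans_le h').not_ge]
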